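/- Let σ, μ ∈ ℝ satisfy e^{2πμ} > sinh²(2πσ), and set r := √(e^{2πμ} − sinh²(2πσ)) > 0. Define W̃ := [Li₂(−e^{−2π(μ+σ)}(sinh(2πσ) − ir)) + Li₂(e^{2πσ}/(sinh(2πσ) − ir))]/(8π²) + μ²/8 + iμ/8 − 1/32 + (Log(i e^{−πμ}(sinh(2πσ) − ir)))²/(8π²), with principal branches. (W̃ equals the analytically continued Painlevé III₃ generating function value W(iσ, −μ − i/2).) Then f_𝓠(σ,μ) = 4iπ·W̃ − Li₂(−e^{2πμ})/(2πi) − 2iπσ² + iπ/4. -/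

import Mathlib

open MeasureTheory

noncomputable section

/-- The dilogarithm `Li₂(z) = -∫₀¹ Log(1 - t z) dt / t` (principal branch of `Log`). -/
def Li2 (z : ℂ) : ℂ := -∫ t in (0:ℝ)..1, Complex.log (1 - (t:ℂ) * z) / (t:ℂ)

/-- Negative-index polylogarithms: `LiNeg m = Li_{-m}`, with `Li₀(w) = w/(1-w)` and
`Li_{-m}(w) = w ⬝ d/dw Li_{-m+1}(w)`. -/
def LiNeg : ℕ → ℂ → ℂ
  | 0 => fun w => w / (1 - w)
  | (m+1) => fun w => w * deriv (LiNeg m) w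

/-- `LiIdx n = Li_{2-2n}`: the dilogarithm for `n = 0`, and `Li_{-(2n-2)}` for `n ≥ 1`. -/
def LiIdx (n : ℕ) : ℂ → ℂ := if n = 0 then Li2 else LiNeg (2*n - 2)

/-- `L_b(z) = i ∫₀^∞ ( sin(2yz)/(2 sinh(y/b) sinh(by)) - z/y ) dy/y`. -/
def Lb (b : ℝ) (z : ℂ) : ℂ :=
  Complex.I * ∫ y in Set.Ioi (0:ℝ),
    (Complex.sin (2 * (y:ℂ) * z) / (2 * (Real.sinh (y / b) : ℂ) * (Real.sinh (b * y) : ℂ))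
      - z / (y:ℂ)) / (y:ℂ)

/-- Ruijsenaars' hyperbolic gamma function `s_b(z) = exp(L_b(z))`. -/
def sb (b : ℝ) (z : ℂ) : ℂ := Complex.exp (Lb b z)

/-- `Q = b + b⁻¹` as a complex number. -/
def Qb (b : ℝ) : ℂ := (b:ℂ) + (b:ℂ)⁻¹

/-- The function `𝓜(b, ζ', ω')`, the contour being the horizontal line `Im = -Q/4`. -/
def Mfun (b : ℝ) (ζ : ℝ) (ω : ℂ) : ℂ :=
  sb b ζ * ∫ x : ℝ,
    Complex.exp (Complex.I * (Real.pi:ℂ) * ((x:ℂ) - Complex.I * Qb b / 4)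
        * ((ζ:ℂ) - Complex.I * Qb b / 2 + 2 * ω)) *
      sb b ((x:ℂ) - Complex.I * Qb b / 4 - (ζ:ℂ))
        / sb b ((x:ℂ) - Complex.I * Qb b / 4 + Complex.I * Qb b / 2)

/-- The exponent `f_𝓜(ζ, ω)`. -/
def fM (ζ : ℝ) (ω : ℂ) : ℂ :=
  -(Li2 (-Complex.exp (2 * (Real.pi:ℂ) * (ζ:ℂ)))
    + Li2 (-(Complex.exp (-((Real.pi:ℂ) * (ζ:ℂ))) * Complex.cosh ((Real.pi:ℂ) * ω)
        / Complex.sinh ((Real.pi:ℂ) * ((ζ:ℂ) + ω))))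
    - Li2 (Complex.exp ((Real.pi:ℂ) * (ζ:ℂ)) * Complex.cosh ((Real.pi:ℂ) * ω)
        / Complex.sinh ((Real.pi:ℂ) * ((ζ:ℂ) + ω))))
    / (2 * (Real.pi:ℂ) * Complex.I)
  + Complex.I * (Real.pi:ℂ) * (ζ:ℂ)^2
  + Complex.I * (ω - Complex.I / 2) *
      Complex.log (Complex.exp ((Real.pi:ℂ) * (ζ:ℂ)) * Complex.cosh ((Real.pi:ℂ) * ω)
        / Complex.sinh ((Real.pi:ℂ) * ((ζ:ℂ) + ω)))
  + Complex.I * (Real.pi:ℂ) / 6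

/-- The function `𝓠(b, σ', μ')`, the contour being the horizontal line `Im = -3Q/8`. -/
def Qfun (b : ℝ) (σ μ : ℝ) : ℂ :=
  Complex.exp (Complex.I * (Real.pi:ℂ) *
      (1/6 + 7 * (Qb b)^2 / 24 - (μ:ℂ)^2/2 + Complex.I * (μ:ℂ) * Qb b - (σ:ℂ)^2)) * sb b μ *
  ∫ x : ℝ,
    Complex.exp (-(Complex.I * (Real.pi:ℂ) * ((x:ℂ) - 3 * Complex.I * Qb b / 8)^2)) *
    Complex.exp (2 * Complex.I * (Real.pi:ℂ) * ((x:ℂ) - 3 * Complex.I * Qb b / 8)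
      * ((μ:ℂ) - Complex.I * Qb b / 2)) *
    sb b ((x:ℂ) - 3 * Complex.I * Qb b / 8 + (σ:ℂ)) *
    sb b ((x:ℂ) - 3 * Complex.I * Qb b / 8 - (σ:ℂ))

/-- The exponent `f_𝓠(σ, μ)`. -/
def fQ (σ μ : ℝ) : ℂ :=
  -(Li2 (-Complex.exp (2 * (Real.pi:ℂ) * (μ:ℂ)))) / (2 * (Real.pi:ℂ) * Complex.I)
  - Li2 (Complex.exp (-(2 * (Real.pi:ℂ) * (σ:ℂ))) *
      ((Real.cosh (2*Real.pi*σ) : ℂ) + Complex.I *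
        (Real.sqrt (Real.exp (2*Real.pi*μ) - Real.sinh (2*Real.pi*σ)^2) : ℂ)))
    / (2 * (Real.pi:ℂ) * Complex.I)
  - Li2 (Complex.exp (2 * (Real.pi:ℂ) * (σ:ℂ)) *
      ((Real.cosh (2*Real.pi*σ) : ℂ) + Complex.I *
        (Real.sqrt (Real.exp (2*Real.pi*μ) - Real.sinh (2*Real.pi*σ)^2) : ℂ)))
    / (2 * (Real.pi:ℂ) * Complex.I)
  + (1/2 + Complex.I * (μ:ℂ)) *
      Complex.log (-(Real.cosh (2*Real.pi*σ) : ℂ) - Complex.I *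
        (Real.sqrt (Real.exp (2*Real.pi*μ) - Real.sinh (2*Real.pi*σ)^2) : ℂ))
  - (Real.pi:ℂ) * (μ:ℂ) + 5 * (Real.pi:ℂ) * Complex.I / 12

/-- The phase function `f(t)` of the saddle point analysis of `𝓜`. -/
def fMt (ζ : ℝ) (ω t : ℂ) : ℂ :=
  -(Li2 (-Complex.exp (2*(Real.pi:ℂ)*(ζ:ℂ)))
    + Li2 (-Complex.exp (2*(Real.pi:ℂ)*(t-(ζ:ℂ))))
    - Li2 (-Complex.exp (2*(Real.pi:ℂ)*(t+Complex.I/2)))) / (2*(Real.pi:ℂ)*Complex.I)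
  + Complex.I*(Real.pi:ℂ)*(ζ:ℂ)^2 + 2*Complex.I*(Real.pi:ℂ)*t*ω + (Real.pi:ℂ)*t
  + Complex.I*(Real.pi:ℂ)/6

/-- The amplitude `g(t)` of the saddle point analysis of `𝓜`. -/
def gM (t : ℂ) : ℂ :=
  Complex.exp ((Real.pi:ℂ)*t - Complex.log (1 - Complex.exp (2*(Real.pi:ℂ)*t)) / 2)

/-- The error term `E(τ, t)` from the semiclassical analysis of `𝓜`. -/
def Efun (ζ τ : ℝ) (t : ℂ) : ℂ :=
  Complex.I * (Li2 (Complex.exp (2*(Real.pi:ℂ)*t))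
      - Li2 (Complex.exp (Complex.I*(Real.pi:ℂ)*(τ:ℂ) + 2*(Real.pi:ℂ)*t))) / (2*(Real.pi:ℂ)*(τ:ℂ))
  + Complex.log (1 - Complex.exp (2*(Real.pi:ℂ)*t)) / 2
  + (Complex.I*(Real.pi:ℂ)*(τ:ℂ)/12) *
      (Complex.exp (2*(Real.pi:ℂ)*t + Complex.I*(Real.pi:ℂ)*(τ:ℂ))
          / (Complex.exp (2*(Real.pi:ℂ)*t + Complex.I*(Real.pi:ℂ)*(τ:ℂ)) - 1)
        - Complex.exp (2*(Real.pi:ℂ)*(ζ:ℂ)) / (Complex.exp (2*(Real.pi:ℂ)*(ζ:ℂ)) + 1)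
        - Complex.exp (2*(Real.pi:ℂ)*t)
          / (Complex.exp (2*(Real.pi:ℂ)*(ζ:ℂ)) + Complex.exp (2*(Real.pi:ℂ)*t)) + 2)

/-- The phase function `f(t)` of the saddle point analysis of `𝓠`. -/
def fQt (σ μ : ℝ) (t : ℂ) : ℂ :=
  -(Li2 (-Complex.exp (2*(Real.pi:ℂ)*(μ:ℂ)))
    + Li2 (-Complex.exp (2*(Real.pi:ℂ)*(t-(σ:ℂ))))
    + Li2 (-Complex.exp (2*(Real.pi:ℂ)*(t+(σ:ℂ))))) / (2*(Real.pi:ℂ)*Complex.I)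
  + 2*Complex.I*(Real.pi:ℂ)*(μ:ℂ)*t + (Real.pi:ℂ)*(t-(μ:ℂ)) + 5*Complex.I*(Real.pi:ℂ)/12

/-- The amplitude `g(t)` of the saddle point analysis of `𝓠`. -/
def gQ (μ : ℝ) (t : ℂ) : ℂ := Complex.exp ((Real.pi:ℂ)*(t-(μ:ℂ)))

end

theorem aux_slit (z : ℂ) (hz : 0 < z.im) (t : ℝ) : 1 - (t:ℂ) * z ∈ Complex.slitPlane := by
  rw [Complex.mem_slitPlane_iff]
  by_cases ht : t = 0
  · left; simp [ht]
  · right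
    simp [ht, hz.ne']

theorem aux_deriv_t (z : ℂ) (hz : 0 < z.im) (t : ℝ) :
    HasDerivAt (fun t : ℝ => Complex.log (1 - (t:ℂ) * z)) (-z / (1 - (t:ℂ) * z)) t := by
  have h1 : HasDerivAt (fun t : ℝ => 1 - (t:ℂ) * z) (-z) t := by
    have := ((Complex.ofRealCLM.hasDerivAt (x := t)).mul_const z).const_sub 1
    simpa using this
  exact h1.clog_real (aux_slit z hz t)

theorem aux_integrable (z : ℂ) (hz : 0 < z.im) :
    IntervalIntegrable (fun t : ℝ => Complex.log (1 - (t:ℂ) * z) / (t:ℂ)) volume 0 1 := by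
  have hc : ContinuousOn (dslope (fun t : ℝ => Complex.log (1 - (t:ℂ) * z)) 0) Set.univ := by
    rw [continuousOn_dslope Filter.univ_mem]
    exact ⟨fun t _ => (aux_deriv_t z hz t).continuousAt.continuousWithinAt,
      (aux_deriv_t z hz 0).differentiableAt⟩
  have hi : IntervalIntegrable (dslope (fun t : ℝ => Complex.log (1 - (t:ℂ) * z)) 0) volume 0 1 :=
    (hc.mono (Set.subset_univ _)).intervalIntegrable
  refine hi.congr ?_
  intro t ht
  rw [Set.uIoc_of_le zero_le_one] at ht
  have h0 : t ≠ 0 := ht.1.ne'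
  simp only [dslope_of_ne _ h0, slope_def_module]
  simp [div_eq_inv_mul]

theorem Li2_hasDerivAt (z : ℂ) (hz : 0 < z.im) :
    HasDerivAt Li2 (-(Complex.log (1 - z) / z)) z := by
  have hz0 : z ≠ 0 := by rintro rfl; simp at hz
  have hK : IsCompact (Metric.closedBall z (z.im / 2) ×ˢ Set.Icc (0:ℝ) 1) :=
    (isCompact_closedBall _ _).prod isCompact_Icc
  have him : ∀ w ∈ Metric.closedBall z (z.im / 2), 0 < w.im := by
    intro w hw
    rw [Metric.mem_closedBall, dist_eq_norm] at hw
    have := (Complex.abs_im_le_norm (w - z)).trans hw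
    rw [Complex.sub_im, abs_le] at this
    linarith [this.1]
  have hcont : ContinuousOn (fun p : ℂ × ℝ => -(1 - (p.2:ℂ) * p.1)⁻¹)
      (Metric.closedBall z (z.im / 2) ×ˢ Set.Icc (0:ℝ) 1) := by
    apply ContinuousOn.neg
    apply ContinuousOn.inv₀
    · fun_prop
    · rintro ⟨w, t⟩ ⟨hw, -⟩
      exact Complex.slitPlane_ne_zero (aux_slit w (him w hw) t)
  obtain ⟨C, hC⟩ := hK.exists_bound_of_continuousOn hcont
  have key := (intervalIntegral.hasDerivAt_integral_of_dominated_loc_of_deriv_le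
    (μ := volume) (a := 0) (b := 1) (bound := fun _ => C)
    (F := fun (w : ℂ) (t : ℝ) => Complex.log (1 - (t:ℂ) * w) / (t:ℂ))
    (F' := fun (w : ℂ) (t : ℝ) => -(1 - (t:ℂ) * w)⁻¹) (x₀ := z)
    (Metric.closedBall_mem_nhds z (half_pos hz))
    (Filter.Eventually.of_forall fun w => by
      apply Measurable.aestronglyMeasurable
      fun_prop)
    (aux_integrable z hz)
    (by apply Measurable.aestronglyMeasurable; fun_prop)
    (Filter.Eventually.of_forall fun t ht w hw => by
      rw [Set.uIoc_of_le zero_le_one] at ht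
      exact hC (w, t) ⟨hw, ht.1.le, ht.2⟩)
    (by simp)
    (Filter.Eventually.of_forall fun t ht w hw => by
      rw [Set.uIoc_of_le zero_le_one] at ht
      have h0 : (t:ℂ) ≠ 0 := by exact_mod_cast ht.1.ne'
      have h1 : HasDerivAt (fun w : ℂ => 1 - (t:ℂ) * w) (-(t:ℂ)) w := by
        simpa using ((hasDerivAt_id w).const_mul (t:ℂ)).const_sub 1
      have h2 := (h1.clog (aux_slit w (him w hw) t)).div_const (t:ℂ)
      have h3 := Complex.slitPlane_ne_zero (aux_slit w (him w hw) t)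
      refine h2.congr_deriv ?_
      field_simp))
  have hint : ∫ t in (0:ℝ)..1, -(1 - (t:ℂ) * z)⁻¹ = Complex.log (1 - z) / z := by
    rw [intervalIntegral.integral_eq_sub_of_hasDerivAt
      (f := fun t : ℝ => Complex.log (1 - (t:ℂ) * z) / z) _ key.1]
    · simp
    · intro t _
      have h3 := Complex.slitPlane_ne_zero (aux_slit z hz t)
      refine ((aux_deriv_t z hz t).div_const z).congr_deriv ?_
      field_simp
  have := key.2.neg
  rw [hint] at this
  exact this

theorem log_neg_pos (z : ℂ) (hz : 0 < z.im) : Complex.log (-z) = Complex.log z - Real.pi * Complex.I := by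
  simp only [Complex.log, norm_neg, Complex.arg_neg_eq_arg_sub_pi_of_im_pos hz]
  push_cast; ring

theorem log_neg_neg (z : ℂ) (hz : z.im < 0) : Complex.log (-z) = Complex.log z + Real.pi * Complex.I := by
  simp only [Complex.log, norm_neg, Complex.arg_neg_eq_arg_add_pi_of_im_neg hz]
  push_cast; ring

theorem arg_bounds (z : ℂ) (hz : 0 < z.im) : 0 < z.arg ∧ z.arg < Real.pi := by
  have h1 : 0 ≤ z.arg := Complex.arg_nonneg_iff.2 hz.le
  have h2 : z.arg ≠ 0 := fun h => by
    have := (Complex.arg_eq_zero_iff.1 h).2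
    linarith
  have h3 : z.arg ≠ Real.pi := fun h => by
    have := (Complex.arg_eq_pi_iff.1 h).2
    linarith
  exact ⟨lt_of_le_of_ne h1 h2.symm, lt_of_le_of_ne (Complex.arg_le_pi _) h3⟩

theorem log_div_upper (z w : ℂ) (hz : 0 < z.im) (hw : 0 < w.im) :
    Complex.log (z * w⁻¹) = Complex.log z - Complex.log w := by
  have hz0 : z ≠ 0 := by rintro rfl; simp at hz
  have hw0 : w ≠ 0 := by rintro rfl; simp at hw
  have a := arg_bounds z hz
  have b := arg_bounds w hw
  rw [Complex.log_mul hz0 (inv_ne_zero hw0), Complex.log_inv _ b.2.ne, sub_eq_add_neg]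
  rw [Complex.arg_inv, if_neg b.2.ne]
  constructor <;> linarith [a.1, a.2, b.1, b.2]

theorem inv_im_pos (z : ℂ) (hz : 0 < z.im) : 0 < ((1 - z)⁻¹).im := by
  have h : 1 - z ≠ 0 := fun h => by
    have := congrArg Complex.im h
    simp at this; linarith
  rw [Complex.inv_im]
  have := Complex.normSq_pos.2 h
  apply div_pos _ this
  simpa using hz

theorem Li2_three (z : ℂ) (hz : 0 < z.im) :
    Li2 z = Li2 ((1 - z)⁻¹) - Complex.log z * Complex.log (1 - z)
      + Complex.log (z - 1) ^ 2 / 2 + (Real.pi:ℂ)^2 / 3 := by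
  let g : ℂ → ℂ := fun z => Li2 z - Li2 ((1 - z)⁻¹) + Complex.log z * Complex.log (1 - z)
      - Complex.log (z - 1) ^ 2 / 2
  have hg : ∀ w ∈ {c : ℂ | 0 < c.im}, HasDerivAt g 0 w := by
    intro w hw
    have hw : 0 < w.im := hw
    have hw0 : w ≠ 0 := by rintro rfl; simp at hw
    have hw1 : 1 - w ≠ 0 := fun h => by
      have := congrArg Complex.im h
      simp at this; linarith
    have hw1' : w - 1 ≠ 0 := fun h => hw1 (by rw [← neg_sub, h, neg_zero])
    have d0 : HasDerivAt (fun w : ℂ => 1 - w) (-1) w := by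
      simpa using (hasDerivAt_id w).const_sub 1
    have d1 : HasDerivAt (fun w : ℂ => w - 1) 1 w := by
      simpa using (hasDerivAt_id w).sub_const 1
    have e1 := Li2_hasDerivAt w hw
    have e2 := (Li2_hasDerivAt _ (inv_im_pos w hw)).comp w (d0.inv hw1)
    have e3 := Complex.hasDerivAt_log (z := w) (Or.inr hw.ne')
    have e4 := d0.clog (by right; simp; exact hw.ne')
    have e5 := (d1.clog (by right; simp; exact hw.ne')).pow 2
    have e := ((e1.sub e2).add (e3.mul e4)).sub (e5.div_const 2)
    have hl : Complex.log (1 - (1 - w)⁻¹) = Complex.log w - Complex.log (w - 1) := by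
      rw [← log_div_upper w (w - 1) hw (by simpa using hw)]
      congr 1
      field_simp
      ring
    refine HasDerivAt.congr_deriv e ?_
    rw [hl]
    simp only [Nat.cast_ofNat, Nat.reduceSub, pow_one]
    rw [← neg_sub 1 w] at *
    field_simp
    ring
  have hz3 : (0:ℝ) < (Complex.exp (Real.pi / 3 * Complex.I)).im := by
    rw [show (Real.pi / 3 * Complex.I : ℂ) = ((Real.pi / 3 : ℝ) : ℂ) * Complex.I by push_cast; ring,
      Complex.exp_ofReal_mul_I_im]
    rw [Real.sin_pi_div_three]; positivity
  have hconst : g z = g (Complex.exp (Real.pi / 3 * Complex.I)) :=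
    IsOpen.is_const_of_deriv_eq_zero (s := {c : ℂ | 0 < c.im})
      (isOpen_lt continuous_const Complex.continuous_im)
      (convex_halfSpace_im_gt 0).isPreconnected
      (fun w hw => (hg w hw).differentiableAt.differentiableWithinAt)
      (fun w hw => (hg w hw).deriv) hz hz3
  have hpi := Real.pi_pos
  have hE : 1 - Complex.exp (Real.pi / 3 * Complex.I) = Complex.exp (-(Real.pi / 3 * Complex.I)) := by
    rw [show (-(Real.pi / 3 * Complex.I) : ℂ) = ((-(Real.pi / 3) : ℝ) : ℂ) * Complex.I by
      push_cast; ring, show (Real.pi / 3 * Complex.I : ℂ) = ((Real.pi / 3 : ℝ) : ℂ) * Complex.I by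
      push_cast; ring]
    apply Complex.ext
    · simp only [Complex.sub_re, Complex.one_re, Complex.exp_ofReal_mul_I_re, Real.cos_neg,
        Real.cos_pi_div_three]
      norm_num
    · simp only [Complex.sub_im, Complex.one_im, Complex.exp_ofReal_mul_I_im, Real.sin_neg]
      ring
  have l1 : Complex.log (Complex.exp (Real.pi / 3 * Complex.I)) = Real.pi / 3 * Complex.I := by
    have hh : (Real.pi / 3 * Complex.I : ℂ).im = Real.pi / 3 := by
      rw [show (Real.pi / 3 * Complex.I : ℂ) = ((Real.pi / 3 : ℝ) : ℂ) * Complex.I by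
        push_cast; ring]
      simp
    apply Complex.log_exp <;> rw [hh] <;> linarith
  have l2 : Complex.log (Complex.exp (-(Real.pi / 3 * Complex.I))) = -(Real.pi / 3 * Complex.I) := by
    rw [Complex.exp_neg, Complex.log_inv _ (arg_bounds _ hz3).2.ne, l1]
  have l3 : Complex.log (Complex.exp (Real.pi / 3 * Complex.I) - 1)
      = -(Real.pi / 3 * Complex.I) + Real.pi * Complex.I := by
    rw [← l2, ← log_neg_neg, ← hE, neg_sub]
    rw [← hE]; simpa using hz3
  have hval : g (Complex.exp (Real.pi / 3 * Complex.I)) = (Real.pi:ℂ)^2 / 3 := by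
    simp only [g]
    rw [l3, hE, l2, l1, Complex.exp_neg, inv_inv]
    linear_combination (-(Real.pi:ℂ)^2 / 3) * Complex.I_sq
  rw [hval] at hconst
  simp only [g] at hconst
  linear_combination hconst
theorem fQ_equals_PIII3_generating_function (σ μ : ℝ)
    (h : Real.sinh (2*Real.pi*σ)^2 < Real.exp (2*Real.pi*μ))
    (r : ℝ) (hr : r = Real.sqrt (Real.exp (2*Real.pi*μ) - Real.sinh (2*Real.pi*σ)^2))
    (W : ℂ)
    (hW : W = (Li2 (-(Complex.exp (-(2*(Real.pi:ℂ)*((μ:ℂ)+(σ:ℂ)))) *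
            ((Real.sinh (2*Real.pi*σ) : ℂ) - Complex.I*(r:ℂ))))
          + Li2 (Complex.exp (2*(Real.pi:ℂ)*(σ:ℂ))
            / ((Real.sinh (2*Real.pi*σ) : ℂ) - Complex.I*(r:ℂ)))) / (8*(Real.pi:ℂ)^2)
        + (μ:ℂ)^2/8 + Complex.I*(μ:ℂ)/8 - 1/32
        + (Complex.log (Complex.I * Complex.exp (-((Real.pi:ℂ)*(μ:ℂ))) *
            ((Real.sinh (2*Real.pi*σ) : ℂ) - Complex.I*(r:ℂ))))^2 / (8*(Real.pi:ℂ)^2)) :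
    fQ σ μ = 4*Complex.I*(Real.pi:ℂ)*W
      - Li2 (-Complex.exp (2*(Real.pi:ℂ)*(μ:ℂ))) / (2*(Real.pi:ℂ)*Complex.I)
      - 2*Complex.I*(Real.pi:ℂ)*(σ:ℂ)^2 + Complex.I*(Real.pi:ℂ)/4 := by
  have hrpos : 0 < r := by rw [hr]; exact Real.sqrt_pos.2 (by linarith)
  have hrsq : r^2 = Real.exp (2*Real.pi*μ) - Real.sinh (2*Real.pi*σ)^2 := by
    rw [hr]; exact Real.sq_sqrt (by linarith)
  unfold fQ
  rw [← hr, hW]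
  clear hW hr h
  have hpi : (Real.pi:ℂ) ≠ 0 := by exact_mod_cast Real.pi_ne_zero
  have eS : Complex.exp (2*(Real.pi:ℂ)*(σ:ℂ)) = ((Real.exp (2*Real.pi*σ) : ℝ) : ℂ) := by
    push_cast; rfl
  have eS' : Complex.exp (-(2*(Real.pi:ℂ)*(σ:ℂ))) = ((Real.exp (-(2*Real.pi*σ)) : ℝ) : ℂ) := by
    push_cast; rfl
  have eM : Complex.exp (-((Real.pi:ℂ)*(μ:ℂ))) = ((Real.exp (-(Real.pi*μ)) : ℝ) : ℂ) := by
    push_cast; rfl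
  have eMS : Complex.exp (-(2*(Real.pi:ℂ)*((μ:ℂ)+(σ:ℂ))))
      = ((Real.exp (-(2*Real.pi*μ)) * Real.exp (-(2*Real.pi*σ)) : ℝ) : ℂ) := by
    rw [← Real.exp_add]; push_cast; congr 1; ring
  rw [eS, eS', eM, eMS]
  have hcosh : Real.cosh (2*Real.pi*σ)
      = (Real.exp (2*Real.pi*σ) + Real.exp (-(2*Real.pi*σ))) / 2 := Real.cosh_eq _
  have hsinh : Real.sinh (2*Real.pi*σ)
      = (Real.exp (2*Real.pi*σ) - Real.exp (-(2*Real.pi*σ))) / 2 := Real.sinh_eq _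
  have hEE : Real.exp (2*Real.pi*σ) * Real.exp (-(2*Real.pi*σ)) = 1 := by
    rw [← Real.exp_add]; simp
  have hMM : Real.exp (2*Real.pi*μ) * Real.exp (-(2*Real.pi*μ)) = 1 := by
    rw [← Real.exp_add]; simp
  have lE : Real.log (Real.exp (2*Real.pi*σ)) = 2*Real.pi*σ := Real.log_exp _
  have lE' : Real.log (Real.exp (-(2*Real.pi*σ))) = -(2*Real.pi*σ) := Real.log_exp _
  have lM : Real.log (Real.exp (2*Real.pi*μ)) = 2*Real.pi*μ := Real.log_exp _
  have lm : Real.log (Real.exp (-(Real.pi*μ))) = -(Real.pi*μ) := Real.log_exp _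
  have pE := Real.exp_pos (2*Real.pi*σ)
  have pE' := Real.exp_pos (-(2*Real.pi*σ))
  have pM := Real.exp_pos (2*Real.pi*μ)
  have pm := Real.exp_pos (-(Real.pi*μ))
  generalize Real.exp (2*Real.pi*σ) = E at *
  generalize Real.exp (-(2*Real.pi*σ)) = E' at *
  generalize Real.exp (2*Real.pi*μ) = M at *
  generalize Real.exp (-(2*Real.pi*μ)) = M' at *
  generalize Real.exp (-(Real.pi*μ)) = m at *
  generalize Real.cosh (2*Real.pi*σ) = c at *
  generalize Real.sinh (2*Real.pi*σ) = s at *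
  have hEEc : (E:ℂ) * E' = 1 := by exact_mod_cast hEE
  have hMMc : (M:ℂ) * M' = 1 := by exact_mod_cast hMM
  have hrc : (r:ℂ)^2 = M - s^2 := by exact_mod_cast hrsq
  have hcc : (c:ℂ) = (E + E') / 2 := by exact_mod_cast hcosh
  have hsc : (s:ℂ) = (E - E') / 2 := by exact_mod_cast hsinh
  have hI := Complex.I_sq
  -- basic points
  have ip : 0 < ((s:ℂ) + Complex.I * r).im := by simpa using hrpos
  have cp : 0 < ((c:ℂ) + Complex.I * r).im := by simpa using hrpos
  have im' : ((s:ℂ) - Complex.I * r).im < 0 := by simpa using hrpos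
  have np : (s:ℂ) + Complex.I * r ≠ 0 := fun h => by rw [h] at ip; simp at ip
  have nc : (c:ℂ) + Complex.I * r ≠ 0 := fun h => by rw [h] at cp; simp at cp
  have nm : (s:ℂ) - Complex.I * r ≠ 0 := fun h => by rw [h] at im'; simp at im'
  have hprod : ((s:ℂ) + Complex.I * r) * (s - Complex.I * r) = M := by
    linear_combination hrc - (r:ℂ)^2 * hI
  have hA1 : 1 - (E':ℂ) * (c + Complex.I * r) = E' * (s - Complex.I * r) := by
    rw [hcc, hsc]; linear_combination -hEEc
  have hB1 : 1 - (E:ℂ) * (c + Complex.I * r) = E * (-(s + Complex.I * r)) := by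
    rw [hcc, hsc]; linear_combination -hEEc
  have hA2 : (E':ℂ) * (c + Complex.I * r) - 1 = E' * (-(s - Complex.I * r)) := by
    linear_combination -hA1
  have hB2 : (E:ℂ) * (c + Complex.I * r) - 1 = E * (s + Complex.I * r) := by
    linear_combination -hB1
  have nE : (E:ℂ) ≠ 0 := by exact_mod_cast pE.ne'
  have nE' : (E':ℂ) ≠ 0 := by exact_mod_cast pE'.ne'
  have nM : (M:ℂ) ≠ 0 := by exact_mod_cast pM.ne'
  have hA3 : (1 - (E':ℂ) * (c + Complex.I * r))⁻¹ = E / (s - Complex.I * r) := by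
    rw [hA1, mul_inv, div_eq_mul_inv, eq_inv_of_mul_eq_one_left hEEc]
  have hB3 : (1 - (E:ℂ) * (c + Complex.I * r))⁻¹
      = -(((M' * E' : ℝ) : ℂ) * (s - Complex.I * r)) := by
    rw [hB1]
    apply inv_eq_of_mul_eq_one_right
    push_cast
    linear_combination (M':ℂ) * E * E' * hprod + M * M' * hEEc + hMMc
  have hLA := Li2_three (E' * (c + Complex.I * r)) (by
    rw [Complex.im_ofReal_mul]; positivity)
  have hLB := Li2_three (E * (c + Complex.I * r)) (by
    rw [Complex.im_ofReal_mul]; positivity)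
  rw [hA3, hA1, hA2] at hLA
  rw [hB3, hB1, hB2] at hLB
  have k1 : Complex.log (s - Complex.I * r) = 2*Real.pi*μ - Complex.log (s + Complex.I * r) := by
    have : (s:ℂ) - Complex.I * r = (M:ℂ) * (s + Complex.I * r)⁻¹ := by
      rw [← hprod]; field_simp
    rw [this, Complex.log_ofReal_mul pM (inv_ne_zero np), lM,
      Complex.log_inv _ (arg_bounds _ ip).2.ne]
    push_cast; ring
  have k2 : Complex.log (Complex.I * m * (s - Complex.I * r))
      = Real.pi / 2 * Complex.I + Real.pi * μ - Complex.log (s + Complex.I * r) := by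
    have e : Complex.I * m * (s - Complex.I * r) = (m:ℂ) * (-(((s:ℂ) - Complex.I * r) * (Complex.I)⁻¹)) := by
      rw [Complex.inv_I]; ring
    have e2 : Complex.I * m * (s - Complex.I * r) = (m:ℂ) * (-(s - Complex.I * r) * (Complex.I)⁻¹) := by
      rw [e]; ring
    have nn : -((s:ℂ) - Complex.I * r) ≠ 0 := neg_ne_zero.2 nm
    rw [e2, Complex.log_ofReal_mul pm (mul_ne_zero nn (inv_ne_zero Complex.I_ne_zero)), lm,
      log_div_upper _ _ (by simpa using hrpos) (by simp), log_neg_neg _ im', k1, Complex.log_I]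
    push_cast; ring
  rw [Complex.log_ofReal_mul pE' nc, Complex.log_ofReal_mul pE' nm,
    Complex.log_ofReal_mul pE' (neg_ne_zero.2 nm), log_neg_neg _ im', k1, lE'] at hLA
  rw [Complex.log_ofReal_mul pE nc, Complex.log_ofReal_mul pE np,
    Complex.log_ofReal_mul pE (neg_ne_zero.2 np), log_neg_pos _ ip, lE] at hLB
  have k3 : Complex.log (-(c:ℂ) - Complex.I * r) = Complex.log (c + Complex.I * r) - Real.pi * Complex.I := by
    rw [← log_neg_pos _ cp]; congr 1; ring
  rw [hLA, hLB, k2, k3]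
  generalize Li2 _ = a1
  generalize Li2 (_ / _) = a2
  generalize Li2 _ = a3
  generalize Complex.log (c + Complex.I * r) = L
  generalize Complex.log (s + Complex.I * r) = T
  push_cast
  have hIi : ∀ x : ℂ, x / (2 * Real.pi * Complex.I) = - (Complex.I * x) / (2 * Real.pi) := by
    intro x
    have := Complex.I_ne_zero
    field_simp
    linear_combination x * hI
  simp only [hIi]
  field_simp
  have hI3 : Complex.I ^ 3 = -Complex.I := by linear_combination Complex.I * hI
  ring_nf
  simp only [hI, hI3]
  ring
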